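/- For all integers k ≥ 1 and n ≥ k + 2, ∑_{m=1}^∞ τ(m)·σ'_k(m)/m^n = ζ(n)²·ζ(2n−2k)²·ζ(2n−k)/(ζ(n−k)²·ζ(4n−2k)). -/

import Mathlib

/-- Liouville's function `λ(m) = (-1)^Ω(m)`. -/
def liouvilleLambda (m : ℕ) : ℤ := (-1) ^ (ArithmeticFunction.cardFactors m)

/-- `σ'_k(m) = ∑_{d ∣ m} λ(d) d^k`. -/
def sigmaPrime (k m : ℕ) : ℤ := ∑ d ∈ m.divisors, liouvilleLambda d * (d : ℤ) ^ k

open Finset in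
theorem card_divisors_mul_le (a b : ℕ) :
    #(a * b).divisors ≤ #a.divisors * #b.divisors := by
  rw [Nat.divisors_mul]
  exact card_mul_le

open ArithmeticFunction in
theorem sq_card_divisors_le (m : ℕ) :
    m.divisors.card ^ 2 ≤ (sigma 0 * sigma 0) m := by
  rw [mul_apply, sq, ← Nat.map_div_right_divisors, Finset.sum_map, ← smul_eq_mul]
  refine Finset.card_nsmul_le_sum _ _ _ fun d hd ↦ ?_
  have h := card_divisors_mul_le d (m / d)
  rw [Nat.mul_div_cancel' (Nat.dvd_of_mem_divisors hd)] at h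
  rw [sigma_zero_apply, sigma_zero_apply]
  exact h

open ArithmeticFunction ArithmeticFunction.zeta LSeries.notation in
theorem summable_sq_card_divisors_div_pow {r : ℕ} (hr : 2 ≤ r) :
    Summable fun m : ℕ ↦ (m.divisors.card : ℝ) ^ 2 / (m : ℝ) ^ r := by
  have hz : LSeriesSummable (↗(ζ : ArithmeticFunction ℂ)) (r : ℂ) := by
    have h1 : 1 < (r : ℂ).re := by
      rw [Complex.natCast_re]
      exact_mod_cast hr
    simpa using LSeriesSummable_zeta_iff.mpr h1
  have hσ := LSeriesSummable_mul (LSeriesSummable_mul hz hz) (LSeriesSummable_mul hz hz)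
  have hcast : ((ζ : ArithmeticFunction ℂ) * ζ) * ((ζ : ArithmeticFunction ℂ) * ζ) =
      ((sigma 0 * sigma 0 : ArithmeticFunction ℕ) : ArithmeticFunction ℂ) := by
    rw [← zeta_mul_pow_eq_sigma, pow_zero_eq_zeta]
    simp only [natCoe_mul]
  rw [hcast] at hσ
  refine Summable.of_nonneg_of_le (fun m ↦ by positivity) (fun m ↦ ?_) hσ.norm
  rcases eq_or_ne m 0 with rfl | hm
  · simp
  · rw [LSeries.term_of_ne_zero hm, Complex.cpow_natCast, norm_div, norm_pow, natCoe_apply,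
      Complex.norm_natCast, Complex.norm_natCast]
    gcongr
    exact_mod_cast sq_card_divisors_le m

theorem abs_sigmaPrime_le (k m : ℕ) : |sigmaPrime k m| ≤ m.divisors.card * (m : ℤ) ^ k := by
  rw [← nsmul_eq_mul]
  refine (Finset.abs_sum_le_sum_abs _ _).trans (Finset.sum_le_card_nsmul _ _ _ fun d hd ↦ ?_)
  rw [liouvilleLambda, abs_mul, abs_pow, abs_neg, abs_one, one_pow, one_mul, abs_of_nonneg
    (by positivity)]
  gcongr
  exact Nat.divisor_le hd

open ArithmeticFunction ArithmeticFunction.zeta in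
theorem sigmaPrime_eq_apply (k m : ℕ) :
    sigmaPrime k m =
      (liouville.pmul ((pow k : ArithmeticFunction ℕ) : ArithmeticFunction ℤ) *
        ((ζ : ArithmeticFunction ℕ) : ArithmeticFunction ℤ)) m := by
  rw [coe_mul_zeta_apply]
  refine Finset.sum_congr rfl fun d hd ↦ ?_
  have hd0 : d ≠ 0 := (Nat.pos_of_mem_divisors hd).ne'
  simp [liouvilleLambda, liouville_apply hd0, pow_apply, hd0]

open ArithmeticFunction in
theorem sigmaPrime_mul_of_coprime (k : ℕ) {a b : ℕ} (h : a.Coprime b) :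
    sigmaPrime k (a * b) = sigmaPrime k a * sigmaPrime k b := by
  simp only [sigmaPrime_eq_apply]
  exact ((isMultiplicative_liouville.pmul isMultiplicative_pow.natCast).mul
    isMultiplicative_zeta.natCast).map_mul_of_coprime h

theorem sigmaPrime_prime_pow (k : ℕ) {p : ℕ} (hp : p.Prime) (e : ℕ) :
    sigmaPrime k (p ^ e) = ∑ i ∈ Finset.range (e + 1), (-(p : ℤ) ^ k) ^ i := by
  rw [sigmaPrime, Nat.sum_divisors_prime_pow hp]
  refine Finset.sum_congr rfl fun i _ ↦ ?_
  rw [liouvilleLambda, ArithmeticFunction.cardFactors_apply_prime_pow hp, neg_pow ((p : ℤ) ^ k)]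
  push_cast
  ring

theorem hasSum_succ_mul_geom_sum_mul_pow {x y : ℂ} (hx : ‖x‖ < 1) (hxy : ‖x * y‖ < 1)
    (hy : y ≠ 1) :
    HasSum (fun e : ℕ ↦ ((e + 1 : ℕ) : ℂ) * (∑ i ∈ Finset.range (e + 1), y ^ i) * x ^ e)
      ((1 - x ^ 2 * y) / ((1 - x) ^ 2 * (1 - x * y) ^ 2)) := by
  have hy' : y - 1 ≠ 0 := sub_ne_zero.mpr hy
  have hx1 : 1 - x ≠ 0 := sub_ne_zero.mpr fun h ↦ by simp [← h] at hx
  have hxy1 : 1 - x * y ≠ 0 := sub_ne_zero.mpr fun h ↦ by simp [← h] at hxy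
  have h := (((hasSum_choose_mul_geometric_of_norm_lt_one 1 hxy).mul_left y).sub
    (hasSum_choose_mul_geometric_of_norm_lt_one 1 hx)).div_const (y - 1)
  convert h using 1
  · rfl
  · funext e
    rw [geom_sum_eq hy, Nat.choose_one_right]
    field_simp
    ring
  · field_simp
    ring

theorem riemannZeta_natCast_hasProd {s : ℕ} (hs : 2 ≤ s) :
    HasProd (fun p : Nat.Primes ↦ (1 - ((p : ℂ) ^ s)⁻¹)⁻¹) (riemannZeta s) := by
  have h := riemannZeta_eulerProduct_hasProd (s := (s : ℂ))
    (by rw [Complex.natCast_re]; exact_mod_cast hs)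
  simpa only [Complex.cpow_neg, Complex.cpow_natCast] using h

theorem summable_norm_card_divisors_mul_sigmaPrime {k n : ℕ} (hn : k + 2 ≤ n) :
    Summable fun m : ℕ ↦ ‖(m.divisors.card : ℂ) * (sigmaPrime k m : ℂ) / (m : ℂ) ^ n‖ := by
  obtain ⟨r, rfl⟩ : ∃ r, n = k + r := ⟨n - k, by omega⟩
  refine Summable.of_nonneg_of_le (fun _ ↦ norm_nonneg _) (fun m ↦ ?_)
    (summable_sq_card_divisors_div_pow (r := r) (by omega))
  rcases eq_or_ne m 0 with rfl | hm
  · simp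
  have hm' : (0 : ℝ) < m := by positivity
  have hle : |(sigmaPrime k m : ℝ)| ≤ m.divisors.card * (m : ℝ) ^ k := by
    exact_mod_cast abs_sigmaPrime_le k m
  rw [norm_div, norm_mul, norm_pow, Complex.norm_natCast, Complex.norm_natCast,
    Complex.norm_intCast]
  calc (m.divisors.card : ℝ) * |(sigmaPrime k m : ℝ)| / (m : ℝ) ^ (k + r)
      ≤ m.divisors.card * (m.divisors.card * (m : ℝ) ^ k) / (m : ℝ) ^ (k + r) := by gcongr
    _ = (m.divisors.card : ℝ) ^ 2 / (m : ℝ) ^ r := by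
      rw [pow_add]
      field_simp

theorem tsum_card_divisors_mul_sigmaPrime_prime_pow {k n : ℕ} (hn : k + 2 ≤ n) {p : ℕ}
    (hp : p.Prime) :
    ∑' e : ℕ, ((p ^ e).divisors.card : ℂ) * (sigmaPrime k (p ^ e) : ℂ) / ((p ^ e : ℕ) : ℂ) ^ n =
      (1 + ((p : ℂ) ^ (2 * n - k))⁻¹) /
        ((1 - ((p : ℂ) ^ n)⁻¹) ^ 2 * (1 + ((p : ℂ) ^ (n - k))⁻¹) ^ 2) := by
  have hp0 : (p : ℂ) ≠ 0 := by exact_mod_cast hp.ne_zero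
  have hlt {s : ℕ} (hs : s ≠ 0) : ‖((p : ℂ) ^ s)⁻¹‖ < 1 := by
    rw [norm_inv, norm_pow, Complex.norm_natCast]
    exact inv_lt_one_of_one_lt₀ (one_lt_pow₀ (by exact_mod_cast hp.one_lt) hs)
  have hxy : ((p : ℂ) ^ n)⁻¹ * -(p : ℂ) ^ k = -((p : ℂ) ^ (n - k))⁻¹ := by
    rw [pow_sub₀ _ hp0 (by omega)]
    field_simp
  have hxxy : (((p : ℂ) ^ n)⁻¹) ^ 2 * -(p : ℂ) ^ k = -((p : ℂ) ^ (2 * n - k))⁻¹ := by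
    rw [pow_sub₀ _ hp0 (by omega), pow_mul']
    field_simp
  have hy : -(p : ℂ) ^ k ≠ 1 := fun h ↦ by
    have : (p : ℤ) ^ k = -1 := by
      rw [neg_eq_iff_eq_neg] at h
      exact_mod_cast h
    have : 0 ≤ (p : ℤ) ^ k := by positivity
    omega
  have h := hasSum_succ_mul_geom_sum_mul_pow (hlt (s := n) (by omega))
    (by rw [hxy, norm_neg]; exact hlt (by omega)) hy
  rw [hxy, hxxy, sub_neg_eq_add, sub_neg_eq_add] at h
  rw [← h.tsum_eq]
  refine tsum_congr fun e ↦ ?_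
  rw [sigmaPrime_prime_pow k hp, Nat.divisors_prime_pow hp, Finset.card_map, Finset.card_range]
  push_cast
  rw [inv_pow, div_eq_mul_inv, pow_right_comm]

theorem card_divisors_mul_sigmaPrime_hasProd {k n : ℕ} (hn : k + 2 ≤ n) :
    HasProd (fun p : Nat.Primes ↦ (1 + ((p : ℂ) ^ (2 * n - k))⁻¹) /
        ((1 - ((p : ℂ) ^ n)⁻¹) ^ 2 * (1 + ((p : ℂ) ^ (n - k))⁻¹) ^ 2))
      (∑' m : ℕ, (m.divisors.card : ℂ) * (sigmaPrime k m : ℂ) / (m : ℂ) ^ n) := by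
  have h := EulerProduct.eulerProduct_hasProd
    (f := fun m : ℕ ↦ (m.divisors.card : ℂ) * (sigmaPrime k m : ℂ) / (m : ℂ) ^ n)
    (by simp [sigmaPrime, liouvilleLambda])
    (fun {a b} hab ↦ by
      simp only [hab.card_divisors_mul, sigmaPrime_mul_of_coprime k hab]
      push_cast
      rw [mul_pow, div_mul_div_comm, mul_mul_mul_comm])
    (summable_norm_card_divisors_mul_sigmaPrime hn) (by simp)
  convert h using 2 with p
  exact (tsum_card_divisors_mul_sigmaPrime_prime_pow hn p.prop).symm

/-- For all integers `k ≥ 1` and `n ≥ k + 2`,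
`∑_{m=1}^∞ τ(m)·σ'_k(m)/m^n = ζ(n)²·ζ(2n−2k)²·ζ(2n−k)/(ζ(n−k)²·ζ(4n−2k))`. -/
theorem stmt16 (k n : ℕ) (hk : 1 ≤ k) (hn : k + 2 ≤ n) :
    ∑' m : ℕ+,
        ((m : ℕ).divisors.card : ℂ) * ((sigmaPrime k (m : ℕ) : ℤ) : ℂ) /
          ((m : ℕ) : ℂ) ^ n
      = riemannZeta (n : ℂ) ^ 2 * riemannZeta ((2 * n - 2 * k : ℕ) : ℂ) ^ 2 *
          riemannZeta ((2 * n - k : ℕ) : ℂ) /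
          (riemannZeta ((n - k : ℕ) : ℂ) ^ 2 * riemannZeta ((4 * n - 2 * k : ℕ) : ℂ)) := by
  have hne {s : ℕ} (hs : 2 ≤ s) : riemannZeta s ≠ 0 :=
    riemannZeta_ne_zero_of_one_lt_re (by rw [Complex.natCast_re]; exact_mod_cast hs)
  rw [eq_div_iff (mul_ne_zero (pow_ne_zero 2 (hne (by omega))) (hne (by omega))),
    Function.Injective.tsum_eq PNat.coe_injective
      (f := fun m : ℕ ↦ (m.divisors.card : ℂ) * (sigmaPrime k m : ℂ) / (m : ℂ) ^ n)
      (fun m hm ↦ ⟨⟨m, Nat.pos_of_ne_zero fun h ↦ hm (by simp [h])⟩, rfl⟩)]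
  have hz {s : ℕ} (hs : 2 ≤ s) := riemannZeta_natCast_hasProd hs
  have hz2 {s : ℕ} (hs : 2 ≤ s) := (hz hs).pow 2
  have hL := (card_divisors_mul_sigmaPrime_hasProd hn).mul
    ((hz2 (s := n - k) (by omega)).mul (hz (s := 4 * n - 2 * k) (by omega)))
  have hR := ((hz2 (s := n) (by omega)).mul (hz2 (s := 2 * n - 2 * k) (by omega))).mul
    (hz (s := 2 * n - k) (by omega))
  refine hL.unique ?_
  convert hR using 2 with p
  have hne' {s : ℕ} (hs : s ≠ 0) : ((p : ℂ) ^ s)⁻¹ ^ 2 ≠ 1 := fun h ↦ by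
    have h2 : (p : ℕ) ^ (s * 2) = 1 := by
      rw [inv_pow, inv_eq_one, ← pow_mul] at h
      exact_mod_cast h
    exact (Nat.one_lt_pow (by omega) p.prop.one_lt).ne' h2
  have hv := hne' (s := 2 * n - k) (by omega)
  have hw := hne' (s := n - k) (by omega)
  have hx := hne' (s := n) (by omega)
  rw [show 4 * n - 2 * k = (2 * n - k) * 2 by omega, show 2 * n - 2 * k = (n - k) * 2 by omega,
    pow_mul _ _ 2, pow_mul _ _ 2, ← inv_pow _ 2, ← inv_pow _ 2]
  generalize ((p : ℂ) ^ (2 * n - k))⁻¹ = v at *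
  generalize ((p : ℂ) ^ (n - k))⁻¹ = w at *
  generalize ((p : ℂ) ^ n)⁻¹ = x at *
  have hsplit {t : ℂ} (ht : t ^ 2 ≠ 1) : 1 - t ≠ 0 ∧ 1 + t ≠ 0 := by
    rw [← mul_ne_zero_iff]
    exact fun h ↦ ht (by linear_combination -h)
  obtain ⟨hv1, hv2⟩ := hsplit hv
  obtain ⟨hw1, hw2⟩ := hsplit hw
  obtain ⟨hx1, -⟩ := hsplit hx
  rw [show 1 - v ^ 2 = (1 - v) * (1 + v) by ring, show 1 - w ^ 2 = (1 - w) * (1 + w) by ring]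
  field_simp
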